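/- Let α be real and let V₀, V_ρ : ℝ² → ℝ be continuously differentiable on an open set U ⊆ ℝ × (0,∞) and satisfy the two-dimensional system ρ(∂V₀/∂x₀ + ∂V_ρ/∂ρ) − (α−1)V_ρ = 0 and ∂V₀/∂ρ = ∂V_ρ/∂x₀ on U. Define the meridional vector field V = (V⁰, V¹, V²) on Λ = {(x₀,x₁,x₂) : (x₀, √(x₁²+x₂²)) ∈ U} by V⁰(x) = V₀(x₀, ρ), V¹(x) = (x₁/ρ)·V_ρ(x₀, ρ), V²(x) = (x₂/ρ)·V_ρ(x₀, ρ), where ρ = √(x₁²+x₂²). Then V satisfies, at every point of Λ: (x₁²+x₂²)(∂₀V⁰ + ∂₁V¹ + ∂₂V²) − α(x₁V¹ + x₂V²) = 0, together with the curl-free conditions ∂₁V⁰ = ∂₀V¹, ∂₂V⁰ = ∂₀V², and ∂₂V¹ = ∂₁V². -/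

import Mathlib

noncomputable section

/-- Partial derivative of `V : ℝ → ℝ → ℝ → ℝ` in the 0th variable. -/
def pd0 (h : ℝ → ℝ → ℝ → ℝ) (a b c : ℝ) : ℝ := deriv (fun t => h t b c) a

/-- Partial derivative in the 1st variable. -/
def pd1 (h : ℝ → ℝ → ℝ → ℝ) (a b c : ℝ) : ℝ := deriv (fun t => h a t c) b

/-- Partial derivative in the 2nd variable. -/
def pd2 (h : ℝ → ℝ → ℝ → ℝ) (a b c : ℝ) : ℝ := deriv (fun t => h a b t) c

/-- Partial derivative of `f : ℝ → ℝ → ℝ` in the first variable (`x₀`). -/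
def qd0 (f : ℝ → ℝ → ℝ) (a r : ℝ) : ℝ := deriv (fun t => f t r) a

/-- Partial derivative of `f : ℝ → ℝ → ℝ` in the second variable (`ρ`). -/
def qd1 (f : ℝ → ℝ → ℝ) (a r : ℝ) : ℝ := deriv (fun t => f a t) r

/-- A meridional vector field built from a solution `(V₀, V_ρ)` of the two-dimensional
system is a potential field in a cylindrically layered medium with density `ρ^{−α}`. -/
theorem stmt10 (α : ℝ) (V₀ Vρ : ℝ → ℝ → ℝ) (U : Set (ℝ × ℝ))
    (hUopen : IsOpen U) (hUsub : ∀ q ∈ U, 0 < q.2)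
    (hV₀C1 : ContDiffOn ℝ 1 (fun q : ℝ × ℝ => V₀ q.1 q.2) U)
    (hVρC1 : ContDiffOn ℝ 1 (fun q : ℝ × ℝ => Vρ q.1 q.2) U)
    (hsys1 : ∀ q ∈ U, q.2 * (qd0 V₀ q.1 q.2 + qd1 Vρ q.1 q.2)
      - (α - 1) * Vρ q.1 q.2 = 0)
    (hsys2 : ∀ q ∈ U, qd1 V₀ q.1 q.2 = qd0 Vρ q.1 q.2)
    (W0 W1 W2 : ℝ → ℝ → ℝ → ℝ)
    (hW0 : ∀ a b c, W0 a b c = V₀ a (Real.sqrt (b ^ 2 + c ^ 2)))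
    (hW1 : ∀ a b c, W1 a b c
      = (b / Real.sqrt (b ^ 2 + c ^ 2)) * Vρ a (Real.sqrt (b ^ 2 + c ^ 2)))
    (hW2 : ∀ a b c, W2 a b c
      = (c / Real.sqrt (b ^ 2 + c ^ 2)) * Vρ a (Real.sqrt (b ^ 2 + c ^ 2))) :
    ∀ x₀ x₁ x₂ : ℝ, (x₀, Real.sqrt (x₁ ^ 2 + x₂ ^ 2)) ∈ U →
      ((x₁ ^ 2 + x₂ ^ 2)
          * (pd0 W0 x₀ x₁ x₂ + pd1 W1 x₀ x₁ x₂ + pd2 W2 x₀ x₁ x₂)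
        - α * (x₁ * W1 x₀ x₁ x₂ + x₂ * W2 x₀ x₁ x₂) = 0)
      ∧ pd1 W0 x₀ x₁ x₂ = pd0 W1 x₀ x₁ x₂
      ∧ pd2 W0 x₀ x₁ x₂ = pd0 W2 x₀ x₁ x₂
      ∧ pd2 W1 x₀ x₁ x₂ = pd1 W2 x₀ x₁ x₂ := by
  intro x₀ x₁ x₂ hx
  have hr : 0 < Real.sqrt (x₁ ^ 2 + x₂ ^ 2) := hUsub _ hx
  have hs : 0 < x₁ ^ 2 + x₂ ^ 2 := Real.sqrt_pos.mp hr
  have hsq : Real.sqrt (x₁ ^ 2 + x₂ ^ 2) ^ 2 = x₁ ^ 2 + x₂ ^ 2 := Real.sq_sqrt hs.le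
  have e1 := hsys1 _ hx
  have e2 := hsys2 _ hx
  have d1 : HasDerivAt (fun t => Real.sqrt (t ^ 2 + x₂ ^ 2))
      (x₁ / Real.sqrt (x₁ ^ 2 + x₂ ^ 2)) x₁ := by
    have h := (((hasDerivAt_id x₁).pow 2).add_const (x₂ ^ 2)).sqrt hs.ne'
    refine h.congr_deriv ?_
    simp only [Pi.pow_apply, id]
    field_simp
    norm_num
  have d2 : HasDerivAt (fun t => Real.sqrt (x₁ ^ 2 + t ^ 2))
      (x₂ / Real.sqrt (x₁ ^ 2 + x₂ ^ 2)) x₂ := by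
    have h := (((hasDerivAt_id x₂).pow 2).const_add (x₁ ^ 2)).sqrt hs.ne'
    refine h.congr_deriv ?_
    simp only [Pi.pow_apply, id]
    field_simp
    norm_num
  have key : ∀ f : ℝ → ℝ → ℝ, ContDiffOn ℝ 1 (fun q : ℝ × ℝ => f q.1 q.2) U →
      HasDerivAt (fun t => f t (Real.sqrt (x₁ ^ 2 + x₂ ^ 2)))
        (qd0 f x₀ (Real.sqrt (x₁ ^ 2 + x₂ ^ 2))) x₀ ∧
      HasDerivAt (fun t => f x₀ t)
        (qd1 f x₀ (Real.sqrt (x₁ ^ 2 + x₂ ^ 2))) (Real.sqrt (x₁ ^ 2 + x₂ ^ 2)) := by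
    intro f hf
    have hd : DifferentiableAt ℝ (fun q : ℝ × ℝ => f q.1 q.2)
        (x₀, Real.sqrt (x₁ ^ 2 + x₂ ^ 2)) :=
      (hf.contDiffAt (hUopen.mem_nhds hx)).differentiableAt (by norm_num)
    constructor
    · exact (DifferentiableAt.comp (f := fun t : ℝ => (t, Real.sqrt (x₁ ^ 2 + x₂ ^ 2)))
        x₀ hd (by fun_prop)).hasDerivAt
    · exact (DifferentiableAt.comp (f := fun t : ℝ => (x₀, t))
        (Real.sqrt (x₁ ^ 2 + x₂ ^ 2)) hd (by fun_prop)).hasDerivAt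
  obtain ⟨a0, a1⟩ := key V₀ hV₀C1
  obtain ⟨b0, b1⟩ := key Vρ hVρC1
  have p00 : pd0 W0 x₀ x₁ x₂ = qd0 V₀ x₀ (Real.sqrt (x₁ ^ 2 + x₂ ^ 2)) := by
    unfold pd0; simp only [hW0]; exact a0.deriv
  have p01 : pd1 W0 x₀ x₁ x₂ = qd1 V₀ x₀ (Real.sqrt (x₁ ^ 2 + x₂ ^ 2)) * (x₁ / (Real.sqrt (x₁ ^ 2 + x₂ ^ 2))) := by
    unfold pd1; simp only [hW0]
    exact (HasDerivAt.comp (h₂ := fun t => V₀ x₀ t) x₁ a1 d1).deriv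
  have p02 : pd2 W0 x₀ x₁ x₂ = qd1 V₀ x₀ (Real.sqrt (x₁ ^ 2 + x₂ ^ 2)) * (x₂ / (Real.sqrt (x₁ ^ 2 + x₂ ^ 2))) := by
    unfold pd2; simp only [hW0]
    exact (HasDerivAt.comp (h₂ := fun t => V₀ x₀ t) x₂ a1 d2).deriv
  have c1 := HasDerivAt.comp (h₂ := fun t => Vρ x₀ t) x₁ b1 d1
  have c2 := HasDerivAt.comp (h₂ := fun t => Vρ x₀ t) x₂ b1 d2
  have p10 : pd0 W1 x₀ x₁ x₂ = x₁ / (Real.sqrt (x₁ ^ 2 + x₂ ^ 2)) * qd0 Vρ x₀ (Real.sqrt (x₁ ^ 2 + x₂ ^ 2)) := by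
    unfold pd0; simp only [hW1]; exact (b0.const_mul _).deriv
  have p20 : pd0 W2 x₀ x₁ x₂ = x₂ / (Real.sqrt (x₁ ^ 2 + x₂ ^ 2)) * qd0 Vρ x₀ (Real.sqrt (x₁ ^ 2 + x₂ ^ 2)) := by
    unfold pd0; simp only [hW2]; exact (b0.const_mul _).deriv
  have p11 : pd1 W1 x₀ x₁ x₂ = (1 * (Real.sqrt (x₁ ^ 2 + x₂ ^ 2)) - x₁ * (x₁ / (Real.sqrt (x₁ ^ 2 + x₂ ^ 2)))) / (Real.sqrt (x₁ ^ 2 + x₂ ^ 2)) ^ 2 * Vρ x₀ (Real.sqrt (x₁ ^ 2 + x₂ ^ 2))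
      + x₁ / (Real.sqrt (x₁ ^ 2 + x₂ ^ 2)) * (qd1 Vρ x₀ (Real.sqrt (x₁ ^ 2 + x₂ ^ 2)) * (x₁ / (Real.sqrt (x₁ ^ 2 + x₂ ^ 2)))) := by
    unfold pd1; simp only [hW1]
    exact (((hasDerivAt_id x₁).div d1 hr.ne').mul c1).deriv
  have p12 : pd2 W1 x₀ x₁ x₂ = (0 * (Real.sqrt (x₁ ^ 2 + x₂ ^ 2)) - x₁ * (x₂ / (Real.sqrt (x₁ ^ 2 + x₂ ^ 2)))) / (Real.sqrt (x₁ ^ 2 + x₂ ^ 2)) ^ 2 * Vρ x₀ (Real.sqrt (x₁ ^ 2 + x₂ ^ 2))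
      + x₁ / (Real.sqrt (x₁ ^ 2 + x₂ ^ 2)) * (qd1 Vρ x₀ (Real.sqrt (x₁ ^ 2 + x₂ ^ 2)) * (x₂ / (Real.sqrt (x₁ ^ 2 + x₂ ^ 2)))) := by
    unfold pd2; simp only [hW1]
    exact (((hasDerivAt_const x₂ x₁).div d2 hr.ne').mul c2).deriv
  have p21 : pd1 W2 x₀ x₁ x₂ = (0 * (Real.sqrt (x₁ ^ 2 + x₂ ^ 2)) - x₂ * (x₁ / (Real.sqrt (x₁ ^ 2 + x₂ ^ 2)))) / (Real.sqrt (x₁ ^ 2 + x₂ ^ 2)) ^ 2 * Vρ x₀ (Real.sqrt (x₁ ^ 2 + x₂ ^ 2))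
      + x₂ / (Real.sqrt (x₁ ^ 2 + x₂ ^ 2)) * (qd1 Vρ x₀ (Real.sqrt (x₁ ^ 2 + x₂ ^ 2)) * (x₁ / (Real.sqrt (x₁ ^ 2 + x₂ ^ 2)))) := by
    unfold pd1; simp only [hW2]
    exact (((hasDerivAt_const x₁ x₂).div d1 hr.ne').mul c1).deriv
  have p22 : pd2 W2 x₀ x₁ x₂ = (1 * (Real.sqrt (x₁ ^ 2 + x₂ ^ 2)) - x₂ * (x₂ / (Real.sqrt (x₁ ^ 2 + x₂ ^ 2)))) / (Real.sqrt (x₁ ^ 2 + x₂ ^ 2)) ^ 2 * Vρ x₀ (Real.sqrt (x₁ ^ 2 + x₂ ^ 2))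
      + x₂ / (Real.sqrt (x₁ ^ 2 + x₂ ^ 2)) * (qd1 Vρ x₀ (Real.sqrt (x₁ ^ 2 + x₂ ^ 2)) * (x₂ / (Real.sqrt (x₁ ^ 2 + x₂ ^ 2)))) := by
    unfold pd2; simp only [hW2]
    exact (((hasDerivAt_id x₂).div d2 hr.ne').mul c2).deriv
  rw [p00, p01, p02, p10, p20, p11, p12, p21, p22, hW1, hW2]
  simp only [] at e1 e2 ⊢
  rw [e2]
  clear p00 p01 p02 p10 p20 p11 p12 p21 p22 c1 c2 a0 a1 b0 b1 key d1 d2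
  generalize Real.sqrt (x₁ ^ 2 + x₂ ^ 2) = r at *
  generalize qd0 V₀ x₀ r = A at *
  generalize qd1 Vρ x₀ r = B at *
  generalize Vρ x₀ r = C at *
  generalize qd0 Vρ x₀ r = D at *
  have hr' := hr.ne'
  refine ⟨?_, by ring, by ring, by field_simp⟩
  have hx1 : x₁ ^ 2 = r ^ 2 - x₂ ^ 2 := by linarith
  have : r ^ 2 * (A + B + C / r) - α * (r * C) = 0 := by
    field_simp
    linear_combination r * e1
  rw [← this, ← hsq]
  field_simp
  rw [hx1]
  ring
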